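/- Let 𝒜 : ℝ^{m×n} → ℝ^d be a linear map, b ∈ ℝ^d, λ > 0, a > 0, and 0 < μ < 1/‖𝒜‖₂². Suppose the sequence {X^k} in ℝ^{m×n} satisfies, for every k, that X^{k+1} is a global minimizer of the map X ↦ C_{λ,μ}(X, X^k). Then the sequence {C_λ(X^k)} is non-increasing: C_λ(X^{k+1}) ≤ C_λ(X^k) for all k. -/

import Mathlib

open Matrix
attribute [local instance] Matrix.frobeniusNormedAddCommGroup Matrix.frobeniusNormedSpace

/-- The singular values of a real `m × n` matrix `X` (in some order):
the square roots of the eigenvalues of the positive semidefinite matrix `X * Xᴴ = X * Xᵀ`. -/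
noncomputable def singVals {m n : ℕ} (X : Matrix (Fin m) (Fin n) ℝ) : Fin m → ℝ :=
  fun i => Real.sqrt ((Matrix.isHermitian_mul_conjTranspose_self X).eigenvalues i)

/-- The non-convex surrogate `P_a(X) = ∑_{i=1}^m a σ_i(X) / (a σ_i(X) + 1)`. -/
noncomputable def Pa {m n : ℕ} (a : ℝ) (X : Matrix (Fin m) (Fin n) ℝ) : ℝ :=
  ∑ i : Fin m, a * singVals X i / (a * singVals X i + 1)

/-- The objective `C_λ(X) = ‖𝒜(X) − b‖₂² + λ P_a(X)`. -/
noncomputable def Cobj {m n d : ℕ}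
    (A : Matrix (Fin m) (Fin n) ℝ →L[ℝ] EuclideanSpace ℝ (Fin d))
    (b : EuclideanSpace ℝ (Fin d)) (lam a : ℝ) (X : Matrix (Fin m) (Fin n) ℝ) : ℝ :=
  ‖A X - b‖ ^ 2 + lam * Pa a X

/-- The surrogate `C_{λ,μ}(X, Z) = μ [C_λ(X) − ‖𝒜(X) − 𝒜(Z)‖₂²] + ‖X − Z‖_F²`. -/
noncomputable def Csur {m n d : ℕ}
    (A : Matrix (Fin m) (Fin n) ℝ →L[ℝ] EuclideanSpace ℝ (Fin d))
    (b : EuclideanSpace ℝ (Fin d)) (lam a μ : ℝ) (X Z : Matrix (Fin m) (Fin n) ℝ) : ℝ :=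
  μ * (Cobj A b lam a X - ‖A X - A Z‖ ^ 2) + ‖X - Z‖ ^ 2

/-- If `0 < μ < 1/‖𝒜‖₂²` and for every `k` the iterate `X^{k+1}` is a global minimizer of
`X ↦ C_{λ,μ}(X, X^k)`, then the sequence `C_λ(X^k)` is non-increasing. -/
theorem objective_decreasing {m n d : ℕ}
    (A : Matrix (Fin m) (Fin n) ℝ →L[ℝ] EuclideanSpace ℝ (Fin d))
    (b : EuclideanSpace ℝ (Fin d)) (lam a μ : ℝ)
    (hlam : 0 < lam) (ha : 0 < a) (hμ0 : 0 < μ) (hμ : μ < 1 / (@norm _ (ContinuousLinearMap.hasOpNorm (σ₁₂ := RingHom.id ℝ)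
      (E := Matrix (Fin m) (Fin n) ℝ) (F := EuclideanSpace ℝ (Fin d))) A) ^ 2)
    (Xseq : ℕ → Matrix (Fin m) (Fin n) ℝ)
    (hmin : ∀ k, ∀ X : Matrix (Fin m) (Fin n) ℝ,
      Csur A b lam a μ (Xseq (k + 1)) (Xseq k) ≤ Csur A b lam a μ X (Xseq k)) :
    ∀ k, Cobj A b lam a (Xseq (k + 1)) ≤ Cobj A b lam a (Xseq k) := by
  intro k
  have h := hmin k (Xseq k)
  have hb : ‖A (Xseq (k + 1) - Xseq k)‖ ≤ (@norm _ (ContinuousLinearMap.hasOpNorm (σ₁₂ := RingHom.id ℝ)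
      (E := Matrix (Fin m) (Fin n) ℝ) (F := EuclideanSpace ℝ (Fin d))) A) * ‖Xseq (k + 1) - Xseq k‖ :=
    ContinuousLinearMap.le_opNorm (σ₁₂ := RingHom.id ℝ)
      (E := Matrix (Fin m) (Fin n) ℝ) (F := EuclideanSpace ℝ (Fin d)) A _
  rw [map_sub] at hb
  generalize (@norm _ (ContinuousLinearMap.hasOpNorm (σ₁₂ := RingHom.id ℝ)
      (E := Matrix (Fin m) (Fin n) ℝ) (F := EuclideanSpace ℝ (Fin d))) A) = N at hμ hb
  have hN : 0 < N ^ 2 := by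
    rcases (sq_nonneg N).eq_or_lt with h0 | h0
    · rw [← h0] at hμ
      norm_num at hμ
      linarith
    · exact h0
  rw [lt_div_iff₀ hN] at hμ
  unfold Csur at h
  simp only [sub_self, norm_zero] at h
  have h2 : ‖A (Xseq (k + 1)) - A (Xseq k)‖ ^ 2 ≤ (N * ‖Xseq (k + 1) - Xseq k‖) ^ 2 :=
    pow_le_pow_left₀ (norm_nonneg _) hb 2
  have h3 := mul_le_mul_of_nonneg_left h2 hμ0.le
  have h4 := mul_le_mul_of_nonneg_right hμ.le (sq_nonneg ‖Xseq (k + 1) - Xseq k‖)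
  refine le_of_mul_le_mul_left ?_ hμ0
  nlinarith
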